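/- Let p be a prime, K : ℤ → ℂ a p-periodic function, and G : ℝ² → ℂ a smooth compactly supported function. Then Σ_{m,n ∈ ℤ} K(mn) G(m,n) = (K̂(0)/√p) Σ_{m,n ∈ ℤ} G(m,n) + (1/p) Σ_{m,n ∈ ℤ} K̃(mn) Ĝ(m/p, n/p), where K̃ is the Voronoi transform of K and Ĝ is the two-dimensional Fourier transform of G. -/

import Mathlib

open Finset

noncomputable def e (z : ℂ) : ℂ := Complex.exp (2 * Real.pi * Complex.I * z)

noncomputable def dft (q : ℕ) (K : ℤ → ℂ) (n : ℤ) : ℂ :=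
  (1 / Real.sqrt q) * ∑ h ∈ Finset.range q, K h * e ((h * n : ℤ) / (q : ℂ))

noncomputable def vor (p : ℕ) (K : ℤ → ℂ) (n : ℤ) : ℂ :=
  (1 / Real.sqrt p) * ∑ h ∈ (Finset.range p).filter (fun h => Nat.Coprime h p),
    dft p K h * e ((n * (((h : ZMod p)⁻¹).val : ℤ) : ℤ) / (p : ℂ))

/-- Two-dimensional Fourier transform `Ĝ(ξ,η) = ∬ G(s,t) e(−(sξ+tη)) ds dt`. -/
noncomputable def ft2 (G : ℝ → ℝ → ℂ) (ξ η : ℝ) : ℂ :=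
  ∫ s : ℝ, ∫ t : ℝ, G s t * e (-(s * ξ + t * η))

open MeasureTheory

lemma e_add (a b : ℂ) : e (a + b) = e a * e b := by
  unfold e; rw [← Complex.exp_add]; ring_nf

lemma e_int (n : ℤ) : e n = 1 := by
  unfold e; rw [Complex.exp_eq_one_iff]; exact ⟨n, by ring⟩

lemma e_zero : e 0 = 1 := by simp [e]

lemma e_eq_one_iff (z : ℂ) : e z = 1 ↔ ∃ n : ℤ, z = n := by
  constructor
  · intro h
    unfold e at h
    rw [Complex.exp_eq_one_iff] at h
    obtain ⟨n, hn⟩ := h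
    refine ⟨n, ?_⟩
    have : (2 * Real.pi * Complex.I : ℂ) ≠ 0 := Complex.two_pi_I_ne_zero
    apply mul_left_cancel₀ this
    rw [hn]; ring
  · rintro ⟨n, rfl⟩; exact e_int n

lemma e_smooth (a : ℂ) : ContDiff ℝ (⊤ : ℕ∞) (fun x : ℝ => e (a * x)) := by
  unfold e
  have h : ContDiff ℝ (⊤ : ℕ∞) (fun x : ℝ => (x : ℂ)) := Complex.ofRealCLM.contDiff
  fun_prop

lemma e_cont : Continuous e := by unfold e; fun_prop

noncomputable def ft1 (g : ℝ → ℂ) (ξ : ℝ) : ℂ := ∫ s : ℝ, g s * e (-(s * ξ))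

open scoped FourierTransform in
lemma ft1_eq (g : ℝ → ℂ) : ft1 g = 𝓕 g := by
  funext ξ
  rw [Real.fourier_real_eq_integral_exp_smul]
  unfold ft1 e
  congr 1; funext s
  rw [smul_eq_mul, mul_comm]
  congr 2
  push_cast; ring

/-- Poisson plus summability. -/
lemma poisson (g : ℝ → ℂ) (hg : ContDiff ℝ (⊤ : ℕ∞) g) (hc : HasCompactSupport g) (x : ℝ) :
    (∑' n : ℤ, g (x + n) = ∑' n : ℤ, ft1 g n * e (n * x)) ∧ Summable (fun n : ℤ => ft1 g n) := by
  constructor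
  · have h := SchwartzMap.tsum_eq_tsum_fourier (hc.toSchwartzMap hg) x
    simp only [HasCompactSupport.toSchwartzMap_toFun, SchwartzMap.fourier_coe] at h
    refine h.trans ?_
    congr 1; funext n
    rw [ft1_eq, fourier_coe_apply]
    unfold e
    congr 1
    congr 1
    push_cast; ring
  · have h := (FourierTransform.fourier (hc.toSchwartzMap hg)).isBigO_cocompact_rpow (-2)
    rw [SchwartzMap.fourier_coe] at h
    have h2 := summable_of_isBigO (Real.summable_abs_int_rpow one_lt_two)
      ((Asymptotics.isBigO_norm_left.mpr h).comp_tendsto Int.tendsto_coe_cofinite)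
    rw [ft1_eq]
    exact h2.of_norm

lemma ft1_scale (g : ℝ → ℂ) (p : ℝ) (hp : 0 < p) (ξ : ℝ) :
    ft1 (fun x => g (p * x)) ξ = (1 / p : ℂ) * ft1 g (ξ / p) := by
  unfold ft1
  have := Measure.integral_comp_mul_left (fun s : ℝ => g s * e (-(s * (ξ / p : ℝ)))) p
  rw [abs_of_pos (inv_pos.mpr hp), Complex.real_smul] at this
  rw [show (1 / p : ℂ) = ((p⁻¹ : ℝ) : ℂ) by push_cast; simp, ← this]
  congr 1; funext s
  congr 2
  have : (p : ℂ) ≠ 0 := by exact_mod_cast hp.ne'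
  push_cast; field_simp

lemma ft1_mod (g : ℝ → ℂ) (a ξ : ℝ) :
    ft1 (fun x => g x * e (a * x)) ξ = ft1 g (ξ - a) := by
  unfold ft1
  congr 1; funext s
  rw [mul_assoc, ← e_add]
  congr 2
  push_cast; ring

lemma comp_scale (g : ℝ → ℂ) (hg : ContDiff ℝ (⊤ : ℕ∞) g) (hc : HasCompactSupport g) (p : ℝ)
    (hp : p ≠ 0) : ContDiff ℝ (⊤ : ℕ∞) (fun x => g (p * x)) ∧
      HasCompactSupport (fun x => g (p * x)) :=
  ⟨by fun_prop, hc.comp_homeomorph (Homeomorph.mulLeft₀ p hp)⟩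

lemma summable_ft1 (g : ℝ → ℂ) (hg : ContDiff ℝ (⊤ : ℕ∞) g) (hc : HasCompactSupport g) (p : ℕ)
    (hp : 0 < p) : Summable (fun n : ℤ => ft1 g ((n : ℝ) / p)) := by
  have hp' : (0 : ℝ) < p := by exact_mod_cast hp
  obtain ⟨h1, h2⟩ := comp_scale g hg hc p hp'.ne'
  have := (poisson _ h1 h2 0).2
  simp_rw [ft1_scale g p hp'] at this
  refine (summable_mul_left_iff ?_).mp this
  simp; omega

lemma poisson_prog (g : ℝ → ℂ) (hg : ContDiff ℝ (⊤ : ℕ∞) g) (hc : HasCompactSupport g) (p : ℕ)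
    (hp : 0 < p) (a : ℤ) : ∑' n : ℤ, g ((a + p * n : ℤ) : ℝ) =
      (1 / p : ℂ) * ∑' v : ℤ, e ((v * a : ℤ) / (p : ℂ)) * ft1 g ((v : ℝ) / p) := by
  have hp' : (0 : ℝ) < p := by exact_mod_cast hp
  have hpc : (p : ℂ) ≠ 0 := by exact_mod_cast hp.ne'
  obtain ⟨h1, h2⟩ := comp_scale g hg hc p hp'.ne'
  have := (poisson _ h1 h2 (a / p)).1
  rw [← tsum_mul_left]
  convert this using 1
  · congr 1; funext n; congr 1; push_cast; field_simp
  · congr 1; funext n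
    rw [ft1_scale g p hp']
    push_cast
    rw [mul_div_assoc]; ring

lemma poisson_mod (g : ℝ → ℂ) (hg : ContDiff ℝ (⊤ : ℕ∞) g) (hc : HasCompactSupport g) (p : ℕ)
    (hp : 0 < p) (c : ℤ) : ∑' m : ℤ, e (-((c * m : ℤ) / (p : ℂ))) * g m =
      ∑' k : ℤ, ft1 g (((c + p * k : ℤ) : ℝ) / p) := by
  have hpc : (p : ℂ) ≠ 0 := by exact_mod_cast hp.ne'
  have hpr : (p : ℝ) ≠ 0 := by exact_mod_cast hp.ne'
  have := (poisson (fun x : ℝ => g x * e (((-(c / p) : ℝ) : ℂ) * x)) (hg.mul (e_smooth _))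
    hc.mul_right 0).1
  simp_rw [ft1_mod] at this
  convert this using 1
  · congr 1; funext n
    rw [mul_comm]; congr 1
    · simp
    · congr 1; push_cast; ring
  · congr 1; funext n
    simp only [Complex.ofReal_zero, mul_zero, e_zero, mul_one]
    congr 1; push_cast; field_simp; ring

lemma tsum_prog (f : ℤ → ℂ) (p : ℕ) (hp : 0 < p) (a : ℤ) :
    ∑' k : ℤ, f (a + p * k) = ∑' w : ℤ, if (p : ℤ) ∣ w - a then f w else 0 := by
  have hpz : (p : ℤ) ≠ 0 := by exact_mod_cast hp.ne'
  have hinj : Function.Injective (fun k : ℤ => a + p * k) := by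
    intro x y h
    simpa [hp.ne'] using h
  rw [← hinj.tsum_eq (f := fun w => if (p : ℤ) ∣ w - a then f w else 0)]
  · congr 1; funext k; simp
  · intro w hw
    simp only [Function.mem_support, ne_eq, ite_eq_right_iff, Classical.not_imp] at hw
    obtain ⟨⟨k, hk⟩, -⟩ := hw
    exact ⟨k, by simp only; omega⟩

open scoped Convolution in
lemma ft1_param_smooth (G : ℝ → ℝ → ℂ) (hG : ContDiff ℝ (⊤ : ℕ∞) (fun x : ℝ × ℝ => G x.1 x.2))
    (hGc : HasCompactSupport (fun x : ℝ × ℝ => G x.1 x.2)) (ξ : ℝ) :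
    ContDiff ℝ (⊤ : ℕ∞) (fun t => ft1 (fun s => G s t) ξ) := by
  have hk : IsCompact ((fun x : ℝ × ℝ => - x.1) '' tsupport (fun x : ℝ × ℝ => G x.1 x.2)) :=
    hGc.isCompact.image (by fun_prop)
  have h := contDiffOn_convolution_right_with_param (𝕜 := ℝ) (μ := volume) (n := ⊤)
    (f := fun s : ℝ => e (-(s * ξ))) (ContinuousLinearMap.mul ℝ ℂ) (g := fun t s => G (-s) t)
    (s := Set.univ) isOpen_univ hk ?_ ?_ ?_
  · rw [Set.univ_prod_univ, contDiffOn_univ] at h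
    have h2 : ContDiff ℝ (⊤ : ℕ∞) (fun t : ℝ => (t, (0 : ℝ))) := by fun_prop
    have h3 := h.comp h2
    convert h3 using 1
    funext t
    simp only [Function.comp, MeasureTheory.convolution, ft1, ContinuousLinearMap.mul_apply']
    congr 1; funext s
    rw [mul_comm]; simp
  · intro t s _ hs
    by_contra h0
    apply hs
    refine ⟨(-s, t), subset_tsupport _ h0, by simp⟩
  · apply Continuous.locallyIntegrable
    exact e_cont.comp (by fun_prop)
  · apply ContDiff.contDiffOn
    exact hG.comp (f := fun x : ℝ × ℝ => (-x.2, x.1)) (by fun_prop)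

lemma ft2_eq (G : ℝ → ℝ → ℂ) (hG : ContDiff ℝ (⊤ : ℕ∞) (fun x : ℝ × ℝ => G x.1 x.2))
    (hGc : HasCompactSupport (fun x : ℝ × ℝ => G x.1 x.2)) (ξ η : ℝ) :
    ft2 G ξ η = ft1 (fun t => ft1 (fun s => G s t) ξ) η := by
  unfold ft2
  rw [integral_integral_swap_of_hasCompactSupport]
  · unfold ft1
    congr 1; funext t
    rw [← integral_mul_const]
    congr 1; funext s
    rw [mul_assoc, ← e_add]; congr 2; ring
  · exact hG.continuous.mul (e_cont.comp (by fun_prop))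
  · exact hGc.mul_right (f' := fun x : ℝ × ℝ => e (-(x.1 * ξ + x.2 * η)))

lemma exists_box (G : ℝ → ℝ → ℂ) 
    (hGc : HasCompactSupport (fun x : ℝ × ℝ => G x.1 x.2)) :
    ∃ R : ℝ, ∀ s t, (R < |s| ∨ R < |t|) → G s t = 0 := by
  obtain ⟨R, hR⟩ := hGc.isCompact.isBounded.subset_closedBall 0
  refine ⟨R, fun s t h => ?_⟩
  by_contra h0
  have := hR (subset_tsupport (fun x : ℝ × ℝ => G x.1 x.2) (show ((s, t) : ℝ × ℝ) ∈ _ from h0))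
  rw [mem_closedBall_zero_iff, Prod.norm_def, max_le_iff] at this
  simp only [Real.norm_eq_abs] at this
  rcases h with h | h <;> linarith [this.1, this.2]

lemma slice (G : ℝ → ℝ → ℂ) (hG : ContDiff ℝ (⊤ : ℕ∞) (fun x : ℝ × ℝ => G x.1 x.2))
    (R : ℝ) (hR : ∀ s t, (R < |s| ∨ R < |t|) → G s t = 0) (t : ℝ) :
    ContDiff ℝ (⊤ : ℕ∞) (fun s => G s t) ∧ HasCompactSupport (fun s => G s t) := by
  refine ⟨hG.comp (f := fun s : ℝ => (s, t)) (by fun_prop), ?_⟩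
  apply HasCompactSupport.of_support_subset_isCompact (isCompact_closedBall (0 : ℝ) R)
  intro s hs
  rw [mem_closedBall_zero_iff, Real.norm_eq_abs]
  by_contra h
  exact hs (hR s t (Or.inl (not_le.mp h)))

lemma ft1_param_compact (G : ℝ → ℝ → ℂ)
    (R : ℝ) (hR : ∀ s t, (R < |s| ∨ R < |t|) → G s t = 0) (ξ : ℝ) :
    HasCompactSupport (fun t => ft1 (fun s => G s t) ξ) := by
  apply HasCompactSupport.of_support_subset_isCompact (isCompact_closedBall (0 : ℝ) R)
  intro t ht
  rw [mem_closedBall_zero_iff, Real.norm_eq_abs]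
  by_contra h
  apply ht
  simp [ft1, fun s => hR s t (Or.inr (not_le.mp h))]
lemma dvd_swap (p h j w n : ℤ) (hj : p ∣ h * j - 1) : p ∣ w - h * n ↔ p ∣ n - j * w := by
  constructor
  · rintro ⟨a, ha⟩; obtain ⟨b, hb⟩ := hj
    exact ⟨-j * a - b * n, by linear_combination (-j) * ha - n * hb⟩
  · rintro ⟨a, ha⟩; obtain ⟨b, hb⟩ := hj
    exact ⟨-h * a - b * w, by linear_combination (-h) * ha - w * hb⟩

lemma key (p : ℕ) (hp : 0 < p) (h j : ℤ) (hj : (p : ℤ) ∣ h * j - 1)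
    (G : ℝ → ℝ → ℂ) (hG : ContDiff ℝ (⊤ : ℕ∞) (fun x : ℝ × ℝ => G x.1 x.2))
    (hGc : HasCompactSupport (fun x : ℝ × ℝ => G x.1 x.2)) :
    (∑' m : ℤ, ∑' n : ℤ, e (-((h * (m * n) : ℤ) / (p : ℂ))) * G m n
      = (1 / (p : ℂ)) * ∑' u : ℤ, ∑' v : ℤ,
          e ((u * v * j : ℤ) / (p : ℂ)) * ft2 G ((u : ℝ) / p) ((v : ℝ) / p)) ∧
    Summable (fun u : ℤ => ∑' v : ℤ,
          e ((u * v * j : ℤ) / (p : ℂ)) * ft2 G ((u : ℝ) / p) ((v : ℝ) / p)) := by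
  obtain ⟨R, hR⟩ := exists_box G hGc
  set N : ℤ := ⌈R⌉ with hN
  have hI : ∀ m : ℤ, m ∉ Finset.Icc (-N) N → R < |(m : ℝ)| := by
    intro m hm
    have h1 : N < |m| := by
      rw [Finset.mem_Icc, ← abs_le] at hm; exact not_le.mp hm
    have h2 : (N : ℝ) < |(m : ℝ)| := by exact_mod_cast h1
    exact lt_of_le_of_lt (Int.le_ceil R) h2
  have hpc : (p : ℂ) ≠ 0 := by exact_mod_cast hp.ne'
  let Φ : ℝ → ℝ → ℂ := fun ξ t => ft1 (fun s => G s t) ξ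
  have hΦ0 : ∀ ξ t, R < |t| → Φ ξ t = 0 := by
    intro ξ t ht
    simp [Φ, ft1, fun s => hR s t (Or.inr ht)]
  have hsum : ∀ n ∈ Finset.Icc (-N) N, Summable (fun w : ℤ =>
      if (p : ℤ) ∣ w - h * n then Φ ((w : ℝ) / p) n else 0) := by
    intro n _
    obtain ⟨h1, h2⟩ := slice G hG R hR n
    refine Summable.of_norm_bounded (summable_ft1 _ h1 h2 p hp).norm (fun w => ?_)
    split_ifs
    · exact le_rfl
    · simp
  have hw : ∀ w : ℤ, ∑ n ∈ Finset.Icc (-N) N,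
      (if (p : ℤ) ∣ w - h * n then Φ ((w : ℝ) / p) n else 0) =
      (1 / (p : ℂ)) * ∑' v : ℤ,
          e ((w * v * j : ℤ) / (p : ℂ)) * ft2 G ((w : ℝ) / p) ((v : ℝ) / p) := by
    intro w
    rw [← tsum_eq_sum (L := SummationFilter.unconditional ℤ)]
    · simp_rw [dvd_swap p h j w _ hj]
      rw [← tsum_prog (fun n : ℤ => Φ ((w : ℝ) / p) n) p hp (j * w)]
      rw [poisson_prog (Φ ((w : ℝ) / p)) (ft1_param_smooth G hG hGc _)
        (ft1_param_compact G R hR _) p hp (j * w)]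
      congr 2; funext v
      rw [ft2_eq G hG hGc]
      congr 3
      push_cast; ring
    · intro n hn
      rw [hΦ0 _ _ (hI n hn)]; simp
  constructor
  · have s1 : ∀ m : ℤ, ∑' n : ℤ, e (-((h * (m * n) : ℤ) / (p : ℂ))) * G m n =
        ∑ n ∈ Finset.Icc (-N) N, e (-((h * (m * n) : ℤ) / (p : ℂ))) * G m n := by
      intro m
      apply tsum_eq_sum
      intro n hn
      rw [hR _ _ (Or.inr (hI n hn)), mul_zero]
    simp_rw [s1]
    rw [Summable.tsum_finsetSum]
    · have s2 : ∀ n : ℤ, ∑' m : ℤ, e (-((h * (m * n) : ℤ) / (p : ℂ))) * G m n =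
          ∑' w : ℤ, if (p : ℤ) ∣ w - h * n then Φ ((w : ℝ) / p) n else 0 := by
        intro n
        obtain ⟨h1, h2⟩ := slice G hG R hR n
        rw [← tsum_prog (fun w : ℤ => Φ ((w : ℝ) / p) n) p hp (h * n)]
        rw [← poisson_mod (fun s => G s n) h1 h2 p hp (h * n)]
        congr 1; funext m; congr 4; push_cast; ring
      simp_rw [s2]
      rw [← Summable.tsum_finsetSum hsum]
      simp_rw [hw]
      rw [tsum_mul_left]
    · intro n _
      apply summable_of_ne_finset_zero (s := Finset.Icc (-N) N)
      intro m hm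
      rw [hR _ _ (Or.inl (hI m hm)), mul_zero]
  · have := summable_sum hsum
    simp_rw [hw] at this
    exact (summable_mul_left_iff (by simpa using hpc)).mp this

lemma sum_e (p : ℕ) (hp : 0 < p) (a : ℤ) :
    ∑ h ∈ Finset.range p, e ((h * a : ℤ) / (p : ℂ)) = if (p : ℤ) ∣ a then (p : ℂ) else 0 := by
  have hpc : (p : ℂ) ≠ 0 := by exact_mod_cast hp.ne'
  have hpow : ∀ h : ℕ, e ((h * a : ℤ) / (p : ℂ)) = e (a / p) ^ h := by
    intro h
    unfold e
    rw [← Complex.exp_nat_mul]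
    congr 1; push_cast; ring
  simp_rw [hpow]
  split_ifs with hd
  · obtain ⟨b, rfl⟩ := hd
    have : e (((p * b : ℤ) : ℂ) / p) = 1 := by
      rw [e_eq_one_iff]; exact ⟨b, by push_cast; field_simp⟩
    rw [this]; simp
  · have h1 : e ((a : ℂ) / p) ≠ 1 := by
      rw [Ne, e_eq_one_iff]
      rintro ⟨b, hb⟩
      apply hd
      refine ⟨b, ?_⟩
      rw [div_eq_iff hpc] at hb
      have : (a : ℂ) = ((p * b : ℤ) : ℂ) := by rw [hb]; push_cast; ring
      exact_mod_cast this
    rw [geom_sum_eq h1, ← hpow]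
    have : e ((((p : ℕ) : ℤ) * a : ℤ) / (p : ℂ)) = 1 := by
      rw [e_eq_one_iff]; exact ⟨a, by push_cast; field_simp⟩
    rw [this]; simp

lemma dft_inv (p : ℕ) (hp : 0 < p) (K : ℤ → ℂ) (hK : ∀ n : ℤ, K (n + p) = K n) (x : ℤ) :
    K x = ∑ h ∈ Finset.range p, (dft p K h / Real.sqrt p) * e (-((h * x : ℤ) / (p : ℂ))) := by
  have hpc : (p : ℂ) ≠ 0 := by exact_mod_cast hp.ne'
  have hsq : (Real.sqrt p : ℂ) * Real.sqrt p = p := by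
    rw [← Complex.ofReal_mul, Real.mul_self_sqrt (by positivity)]; simp
  have hs0 : (Real.sqrt p : ℂ) ≠ 0 := by
    intro h; rw [h] at hsq; simp only [mul_zero] at hsq; exact hpc hsq.symm
  have hstep : ∀ h : ℕ, (dft p K h / Real.sqrt p) * e (-((h * x : ℤ) / (p : ℂ))) =
      ∑ j ∈ Finset.range p, (1 / (p : ℂ)) * K j * e ((h * (j - x) : ℤ) / (p : ℂ)) := by
    intro h
    unfold dft
    rw [← hsq, Finset.mul_sum, Finset.sum_div, Finset.sum_mul]
    apply Finset.sum_congr rfl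
    intro j _
    rw [hsq]
    have : e ((h * (j - x) : ℤ) / (p : ℂ)) = e ((j * h : ℤ) / (p : ℂ)) *
        e (-((h * x : ℤ) / (p : ℂ))) := by
      rw [← e_add]; congr 1; push_cast; ring
    rw [this, ← hsq]
    field_simp
  simp_rw [hstep]
  rw [Finset.sum_comm]
  simp_rw [← Finset.mul_sum, sum_e p hp]
  have hpz : (p : ℤ) ≠ 0 := by exact_mod_cast hp.ne'
  have hm0 := Int.emod_nonneg x hpz
  have hm1 := Int.emod_lt_of_pos x (show (0 : ℤ) < p by exact_mod_cast hp)
  have hmc : (((x % p).toNat : ℕ) : ℤ) = x % p := Int.toNat_of_nonneg hm0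
  rw [Finset.sum_eq_single (x % p).toNat]
  · have hd : (p : ℤ) ∣ ((x % p).toNat : ℤ) - x := by
      rw [hmc]; exact Int.dvd_emod_sub_self
    rw [if_pos hd, hmc]
    have hper : K (x % p) = K x := by
      have hP : Function.Periodic K (p : ℤ) := hK
      have := hP.int_mul (x / p) (x % p)
      rw [← this]
      congr 1
      have := Int.emod_add_mul_ediv x p
      simp only [Int.cast_id]
      linarith
    rw [hper]; field_simp
  · intro b hb hne
    rw [if_neg, mul_zero]
    intro hd
    apply hne
    have hb' : (b : ℤ) < p := by exact_mod_cast Finset.mem_range.mp hb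
    have : (b : ℤ) % p = x % p := 
      Int.emod_eq_emod_iff_emod_sub_eq_zero.mpr (Int.emod_eq_zero_of_dvd hd)
    rw [Int.emod_eq_of_lt (by positivity) hb'] at this
    omega
  · intro h
    exfalso; apply h; rw [Finset.mem_range]; omega

lemma summable_ft2 (p : ℕ) (hp : 0 < p)
    (G : ℝ → ℝ → ℂ) (hG : ContDiff ℝ (⊤ : ℕ∞) (fun x : ℝ × ℝ => G x.1 x.2))
    (hGc : HasCompactSupport (fun x : ℝ × ℝ => G x.1 x.2)) (ξ : ℝ) (c : ℤ → ℤ) :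
    Summable (fun v : ℤ => e ((c v : ℤ) / (p : ℂ)) * ft2 G ξ ((v : ℝ) / p)) := by
  obtain ⟨R, hR⟩ := exists_box G hGc
  have := summable_ft1 _ (ft1_param_smooth G hG hGc ξ) (ft1_param_compact G R hR ξ) p hp
  simp_rw [← ft2_eq G hG hGc] at this
  refine Summable.of_norm_bounded this.norm (fun v => ?_)
  rw [norm_mul]
  have : ‖e ((c v : ℤ) / (p : ℂ))‖ = 1 := by
    unfold e
    rw [Complex.norm_exp, Real.exp_eq_one_iff]
    rw [show 2 * (Real.pi : ℂ) * Complex.I * ((c v : ℤ) / (p : ℂ)) =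
      ((2 * Real.pi * (c v / p) : ℝ) : ℂ) * Complex.I by push_cast; ring]
    simp only [Complex.re_ofReal_mul, Complex.I_re, mul_zero]
  rw [this, one_mul]

lemma tsum2_finset (S : Finset ℕ) (c : ℕ → ℂ) (F : ℕ → ℤ → ℤ → ℂ)
    (h1 : ∀ h ∈ S, ∀ m, Summable (F h m)) (h2 : ∀ h ∈ S, Summable (fun m => ∑' n, F h m n)) :
    ∑' m : ℤ, ∑' n : ℤ, ∑ h ∈ S, c h * F h m n = ∑ h ∈ S, c h * ∑' m : ℤ, ∑' n : ℤ, F h m n := by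
  have : ∀ m, ∑' n : ℤ, ∑ h ∈ S, c h * F h m n = ∑ h ∈ S, c h * ∑' n : ℤ, F h m n := by
    intro m
    rw [Summable.tsum_finsetSum (fun h hh => (h1 h hh m).mul_left _)]
    simp_rw [tsum_mul_left]
  simp_rw [this]
  rw [Summable.tsum_finsetSum (fun h hh => (h2 h hh).mul_left _)]
  simp_rw [tsum_mul_left]

lemma box_summable (G : ℝ → ℝ → ℂ) (hGc : HasCompactSupport (fun x : ℝ × ℝ => G x.1 x.2))
    (a : ℤ → ℤ → ℂ) : (∀ m : ℤ, Summable (fun n : ℤ => a m n * G m n)) ∧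
      Summable (fun m : ℤ => ∑' n : ℤ, a m n * G m n) := by
  obtain ⟨R, hR⟩ := exists_box G hGc
  have hI : ∀ m : ℤ, m ∉ Finset.Icc (-⌈R⌉) ⌈R⌉ → R < |(m : ℝ)| := by
    intro m hm
    have h1 : ⌈R⌉ < |m| := by
      rw [Finset.mem_Icc, ← abs_le] at hm; exact not_le.mp hm
    have h2 : (⌈R⌉ : ℝ) < |(m : ℝ)| := by exact_mod_cast h1
    exact lt_of_le_of_lt (Int.le_ceil R) h2
  constructor
  · intro m
    apply summable_of_ne_finset_zero (s := Finset.Icc (-⌈R⌉) ⌈R⌉)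
    intro n hn
    rw [hR _ _ (Or.inr (hI n hn)), mul_zero]
  · apply summable_of_ne_finset_zero (s := Finset.Icc (-⌈R⌉) ⌈R⌉)
    intro m hm
    simp [fun t => hR m t (Or.inl (hI m hm))]

theorem stmt7 (p : ℕ) (hp : p.Prime) (K : ℤ → ℂ)
    (hK : ∀ n : ℤ, K (n + p) = K n)
    (G : ℝ → ℝ → ℂ) (hG : ContDiff ℝ (⊤ : ℕ∞) (fun x : ℝ × ℝ => G x.1 x.2))
    (hGc : HasCompactSupport (fun x : ℝ × ℝ => G x.1 x.2)) :
    ∑' m : ℤ, ∑' n : ℤ, K (m * n) * G m n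
      = (dft p K 0 / Real.sqrt p) * (∑' m : ℤ, ∑' n : ℤ, G m n)
        + (1 / (p : ℂ)) * ∑' m : ℤ, ∑' n : ℤ,
            vor p K (m * n) * ft2 G ((m : ℝ) / p) ((n : ℝ) / p) := by
  have hp0 := hp.pos
  have : Fact p.Prime := ⟨hp⟩
  have hL : ∑' m : ℤ, ∑' n : ℤ, K (m * n) * G m n = ∑ h ∈ Finset.range p,
      (dft p K h / Real.sqrt p) * ∑' m : ℤ, ∑' n : ℤ,
        e (-((h * (m * n) : ℤ) / (p : ℂ))) * G m n := by
    rw [← tsum2_finset (Finset.range p) (fun h => dft p K h / Real.sqrt p)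
      (fun h m n => e (-((h * (m * n) : ℤ) / (p : ℂ))) * G m n)
      (fun h _ => (box_summable G hGc _).1) (fun h _ => (box_summable G hGc _).2)]
    congr 1; funext m; congr 1; funext n
    rw [dft_inv p hp0 K hK (m * n), Finset.sum_mul]
    apply Finset.sum_congr rfl
    intro h _
    ring
  have hinv : ∀ h ∈ (Finset.range p).filter (fun h => Nat.Coprime h p),
      (p : ℤ) ∣ (h : ℤ) * (((h : ZMod p)⁻¹).val : ℤ) - 1 := by
    intro h hh
    rw [← ZMod.intCast_zmod_eq_zero_iff_dvd]
    push_cast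
    rw [ZMod.natCast_zmod_val, ZMod.coe_mul_inv_eq_one h (Finset.mem_filter.mp hh).2, sub_self]
  have hR : ∑' m : ℤ, ∑' n : ℤ, vor p K (m * n) * ft2 G ((m : ℝ) / p) ((n : ℝ) / p) =
      ∑ h ∈ (Finset.range p).filter (fun h => Nat.Coprime h p),
        (dft p K h / Real.sqrt p) * ∑' u : ℤ, ∑' v : ℤ,
          e ((u * v * (((h : ZMod p)⁻¹).val : ℤ) : ℤ) / (p : ℂ)) *
            ft2 G ((u : ℝ) / p) ((v : ℝ) / p) := by
    rw [← tsum2_finset _ (fun h => dft p K h / Real.sqrt p)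
      (fun h u v => e ((u * v * (((h : ZMod p)⁻¹).val : ℤ) : ℤ) / (p : ℂ)) *
            ft2 G ((u : ℝ) / p) ((v : ℝ) / p))
      (fun h _ m => summable_ft2 p hp0 G hG hGc _ (fun v => m * v * (((h : ZMod p)⁻¹).val : ℤ)))
      (fun h hh => (key p hp0 h _ (hinv h hh) G hG hGc).2)]
    congr 1; funext m; congr 1; funext n
    unfold vor
    rw [Finset.mul_sum, Finset.sum_mul]
    apply Finset.sum_congr rfl
    intro h _
    ring
  rw [hL, hR, ← Finset.sum_filter_add_sum_filter_not (Finset.range p)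
    (fun h => Nat.Coprime h p), add_comm]
  congr 1
  · have : (Finset.range p).filter (fun h => ¬ Nat.Coprime h p) = {0} := by
      ext h
      simp only [Finset.mem_filter, Finset.mem_range, Finset.mem_singleton]
      constructor
      · rintro ⟨h1, h2⟩
        by_contra h0
        exact h2 ((Nat.Prime.coprime_iff_not_dvd hp).mpr
          (fun hd => absurd (Nat.le_of_dvd (Nat.pos_of_ne_zero h0) hd) (not_le.mpr h1))).symm
      · rintro rfl
        exact ⟨hp0, by simpa using hp.one_lt.ne'⟩
    rw [this, Finset.sum_singleton]
    simp [e_zero]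
  · rw [Finset.mul_sum]
    apply Finset.sum_congr rfl
    intro h hh
    rw [(key p hp0 h _ (hinv h hh) G hG hGc).1]
    ring
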